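/- Let n ≥ 2, κ ≥ 1, θ ∈ (0, 1/2), and let w be a Schwartz function on ℝⁿ whose Fourier transform 𝓕w vanishes on {ξ = (ξ', ξ_n) : |ξ'| < κ}. Then there is a constant C(θ), depending only on θ and n, such that ‖w(·,1)‖²_{L²(ℝ^{n−1})} + Σ_{j=1}^{n−1} ‖∂_j w(·,1)‖²_{L²(ℝ^{n−1})} ≤ C(θ) κ^{−1+2θ} ∫_{ℝⁿ} (1+|ξ|²)² |𝓕w(ξ)|² dξ. -/

import Mathlib

open MeasureTheory
open scoped FourierTransform

/-- The tangential part `ξ'` of `ξ = (ξ', ξₙ) ∈ ℝⁿ`, `n = d+1`. -/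
noncomputable def tangentialPart {d : ℕ} (ξ : EuclideanSpace ℝ (Fin (d + 1))) :
    EuclideanSpace ℝ (Fin d) :=
  (EuclideanSpace.equiv (Fin d) ℝ).symm (fun j => ξ (Fin.castSucc j))

/-- The point `(x', t) ∈ ℝⁿ = ℝ^{d}×ℝ`. -/
noncomputable def extendPt {d : ℕ} (x' : EuclideanSpace ℝ (Fin d)) (t : ℝ) :
    EuclideanSpace ℝ (Fin (d + 1)) :=
  (EuclideanSpace.equiv (Fin (d + 1)) ℝ).symm (Fin.snoc (fun j => x' j) t)

open scoped LineDeriv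

/-- The identification of `ℝᵈ × ℝ` with `ℝᵈ⁺¹` preserves Lebesgue measure. -/
lemma measurePreserving_extendPt (d : ℕ) :
    MeasurePreserving (fun p : EuclideanSpace ℝ (Fin d) × ℝ => extendPt p.1 p.2)
      (volume.prod volume) volume := by
  have hsplit : MeasurePreserving (MeasurableEquiv.piFinSuccAbove (fun _ => ℝ) (Fin.last d)).symm
      ((volume : Measure ℝ).prod (volume : Measure (Fin d → ℝ))) volume :=
    (volume_preserving_piFinSuccAbove (fun _ => ℝ) (Fin.last d)).symm
  have hcoords : MeasurePreserving (fun p : EuclideanSpace ℝ (Fin d) × ℝ => (p.2, p.1.ofLp))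
      (volume.prod volume) ((volume : Measure ℝ).prod (volume : Measure (Fin d → ℝ))) :=
    ((MeasurePreserving.id volume).prod (PiLp.volume_preserving_ofLp (Fin d))).comp
      Measure.measurePreserving_swap
  have hcomp : (fun p : EuclideanSpace ℝ (Fin d) × ℝ => extendPt p.1 p.2) =
      WithLp.toLp 2 ∘ (MeasurableEquiv.piFinSuccAbove (fun _ => ℝ) (Fin.last d)).symm ∘
        fun p => (p.2, p.1.ofLp) := by
    funext p
    simp [extendPt, MeasurableEquiv.piFinSuccAbove, Fin.snocEquiv]
  rw [hcomp]
  exact (PiLp.volume_preserving_toLp (Fin (d + 1))).comp (hsplit.comp hcoords)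

/-- The curve `t ↦ (x', t)` has constant velocity `eₙ`. -/
lemma hasDerivAt_extendPt {d : ℕ} (x' : EuclideanSpace ℝ (Fin d)) (t : ℝ) :
    HasDerivAt (extendPt x') (EuclideanSpace.single (Fin.last d) 1) t := by
  have hline : extendPt x' = fun s =>
      extendPt x' 0 + s • EuclideanSpace.single (Fin.last d) (1 : ℝ) := by
    funext s
    ext i
    refine Fin.lastCases ?_ (fun j => ?_) i
    · simp [extendPt]
    · simp [extendPt, (Fin.castSucc_lt_last j).ne]
  rw [hline]
  simpa using ((hasDerivAt_id t).smul_const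
    (EuclideanSpace.single (Fin.last d) (1 : ℝ))).const_add (extendPt x' 0)

lemma SchwartzMap.integrable_norm_sq {E : Type*} [NormedAddCommGroup E] [NormedSpace ℝ E]
    [MeasurableSpace E] [BorelSpace E] [SecondCountableTopology E] {μ : Measure E}
    [μ.HasTemperateGrowth] (v : SchwartzMap E ℂ) : Integrable (fun x => ‖v x‖ ^ 2) μ :=
  (v.memLp 2 μ).integrable_norm_pow (by norm_num)

/-- Pointwise bound of a function on the line by its weighted `H¹` norm. -/
lemma norm_sq_le_integral_add_integral_deriv {g g' : ℝ → ℂ} {κ : ℝ} (hκ : 0 < κ)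
    (hg : ∀ t, HasDerivAt g (g' t) t) (hg' : Continuous g')
    (hint : Integrable fun t => ‖g t‖ ^ 2) (hint' : Integrable fun t => ‖g' t‖ ^ 2) (a : ℝ) :
    ‖g a‖ ^ 2 ≤ ∫ t, κ * ‖g t‖ ^ 2 + κ⁻¹ * ‖g' t‖ ^ 2 := by
  have hcont : Continuous g := continuous_iff_continuousAt.2 fun t => (hg t).continuousAt
  have hH : Integrable fun t => κ * ‖g t‖ ^ 2 + κ⁻¹ * ‖g' t‖ ^ 2 :=
    (hint.const_mul κ).add (hint'.const_mul κ⁻¹)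
  have hbound : ∀ t, |2 * inner ℝ (g t) (g' t)| ≤ κ * ‖g t‖ ^ 2 + κ⁻¹ * ‖g' t‖ ^ 2 := by
    intro t
    have hCS := abs_real_inner_le_norm (g t) (g' t)
    have hsq : κ * ‖g t‖ ^ 2 + κ⁻¹ * ‖g' t‖ ^ 2 - 2 * (‖g t‖ * ‖g' t‖) =
        κ⁻¹ * (κ * ‖g t‖ - ‖g' t‖) ^ 2 := by
      field_simp
      ring
    have hnonneg : 0 ≤ κ⁻¹ * (κ * ‖g t‖ - ‖g' t‖) ^ 2 := by positivity
    rw [abs_mul, abs_two]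
    linarith
  have hderiv : ∀ t, HasDerivAt (fun s => ‖g s‖ ^ 2) (2 * inner ℝ (g t) (g' t)) t :=
    fun t => (hg t).norm_sq
  have hφ' : Integrable fun t => 2 * inner ℝ (g t) (g' t) :=
    hH.mono' (by fun_prop) (.of_forall hbound)
  have hlim := tendsto_zero_of_hasDerivAt_of_integrableOn_Iic (a := a)
    (fun t _ => hderiv t) hφ'.integrableOn hint.integrableOn
  have hFTC := integral_Iic_of_hasDerivAt_of_tendsto' (a := a)
    (fun t _ => hderiv t) hφ'.integrableOn hlim
  calc ‖g a‖ ^ 2 = ∫ t in Set.Iic a, 2 * inner ℝ (g t) (g' t) := by rw [hFTC, sub_zero]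
    _ ≤ ∫ t in Set.Iic a, κ * ‖g t‖ ^ 2 + κ⁻¹ * ‖g' t‖ ^ 2 :=
        integral_mono hφ'.integrableOn hH.integrableOn fun t => (le_abs_self _).trans (hbound t)
    _ ≤ ∫ t, κ * ‖g t‖ ^ 2 + κ⁻¹ * ‖g' t‖ ^ 2 :=
        setIntegral_le_integral hH (.of_forall fun t => by positivity)

/-- Weighted `L²` trace inequality on the hyperplane `{xₙ = a}`. -/
lemma integral_norm_sq_trace_le {d : ℕ} (v : SchwartzMap (EuclideanSpace ℝ (Fin (d + 1))) ℂ)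
    {κ : ℝ} (hκ : 0 < κ) (a : ℝ) :
    ∫ x' : EuclideanSpace ℝ (Fin d), ‖v (extendPt x' a)‖ ^ 2 ≤
      κ * (∫ x, ‖v x‖ ^ 2) +
        κ⁻¹ * ∫ x, ‖(∂_{EuclideanSpace.single (Fin.last d) (1 : ℝ)} v) x‖ ^ 2 := by
  set v' := ∂_{EuclideanSpace.single (Fin.last d) (1 : ℝ)} v
  have hmp := measurePreserving_extendPt d
  have hv := hmp.integrable_comp_of_integrable (v.integrable_norm_sq (μ := volume))
  have hdv := hmp.integrable_comp_of_integrable (v'.integrable_norm_sq (μ := volume))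
  have hH : Integrable (fun x => κ * ‖v x‖ ^ 2 + κ⁻¹ * ‖v' x‖ ^ 2) :=
    (v.integrable_norm_sq.const_mul κ).add (v'.integrable_norm_sq.const_mul κ⁻¹)
  have hHprod := hmp.integrable_comp_of_integrable hH
  have hFubini : ∫ x, κ * ‖v x‖ ^ 2 + κ⁻¹ * ‖v' x‖ ^ 2 =
      ∫ x' : EuclideanSpace ℝ (Fin d), ∫ t : ℝ,
        κ * ‖v (extendPt x' t)‖ ^ 2 + κ⁻¹ * ‖v' (extendPt x' t)‖ ^ 2 := by
    rw [← hmp.map_eq, integral_map hmp.aemeasurable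
      (by rw [hmp.map_eq]; exact hH.aestronglyMeasurable)]
    exact integral_prod _ hHprod
  rw [← integral_const_mul, ← integral_const_mul, ← integral_add
    (v.integrable_norm_sq.const_mul κ) (v'.integrable_norm_sq.const_mul κ⁻¹), hFubini]
  refine integral_mono_of_nonneg (.of_forall fun _ => by positivity) hHprod.integral_prod_left ?_
  filter_upwards [hv.prod_right_ae, hdv.prod_right_ae] with x' hx hdx
  have hcurve : Continuous (extendPt x') :=
    continuous_iff_continuousAt.2 fun t => (hasDerivAt_extendPt x' t).continuousAt
  exact norm_sq_le_integral_add_integral_deriv hκ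
    (fun t => v.differentiableAt.hasFDerivAt.comp_hasDerivAt t (hasDerivAt_extendPt x' t))
    (v'.continuous.comp hcurve) hx hdx a

lemma norm_fourier_lineDerivOp_le {d : ℕ} (v : SchwartzMap (EuclideanSpace ℝ (Fin d)) ℂ)
    (i : Fin d) (ξ : EuclideanSpace ℝ (Fin d)) :
    ‖𝓕 (∂_{EuclideanSpace.single i (1 : ℝ)} v) ξ‖ ≤ 2 * Real.pi * ‖ξ‖ * ‖𝓕 v ξ‖ := by
  have htemp : (fun y : EuclideanSpace ℝ (Fin d) =>
      inner ℝ y (EuclideanSpace.single i (1 : ℝ))).HasTemperateGrowth := by fun_prop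
  have hinner : |inner ℝ ξ (EuclideanSpace.single i (1 : ℝ))| ≤ ‖ξ‖ := by
    simpa using abs_real_inner_le_norm ξ (EuclideanSpace.single i (1 : ℝ))
  rw [SchwartzMap.fourier_lineDerivOp_eq, smul_apply,
    SchwartzMap.smulLeftCLM_apply_apply htemp, norm_smul, norm_smul, ← mul_assoc]
  simp only [norm_mul, Complex.norm_I, Complex.norm_real, Real.norm_eq_abs,
    abs_of_pos Real.pi_pos, Complex.norm_ofNat, mul_one]
  gcongr

lemma integrable_fourier_sobolev_weight {V : Type*} [NormedAddCommGroup V]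
    [InnerProductSpace ℝ V] [FiniteDimensional ℝ V] [MeasurableSpace V] [BorelSpace V]
    (w : SchwartzMap V ℂ) :
    Integrable fun ξ => (1 + ‖ξ‖ ^ 2) ^ 2 * ‖𝓕 w ξ‖ ^ 2 := by
  have htemp : (fun ξ : V => 1 + ‖ξ‖ ^ 2).HasTemperateGrowth := by fun_prop
  refine (SchwartzMap.integrable_norm_sq (μ := volume)
    (SchwartzMap.smulLeftCLM ℂ (fun ξ : V => 1 + ‖ξ‖ ^ 2) (𝓕 w))).congr (.of_forall fun ξ => ?_)
  simp only [SchwartzMap.smulLeftCLM_apply_apply htemp, norm_smul, mul_pow, Real.norm_eq_abs,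
    sq_abs]

/-- Plancherel's theorem turns a pointwise Fourier bound by the `H²` weight into an `L²` bound. -/
lemma integral_norm_sq_le_of_fourier_le {V : Type*} [NormedAddCommGroup V]
    [InnerProductSpace ℝ V] [FiniteDimensional ℝ V] [MeasurableSpace V] [BorelSpace V]
    (v w : SchwartzMap V ℂ) {A : ℝ}
    (h : ∀ ξ, ‖𝓕 v ξ‖ ≤ A * ((1 + ‖ξ‖ ^ 2) * ‖𝓕 w ξ‖)) :
    ∫ x, ‖v x‖ ^ 2 ≤ A ^ 2 * ∫ ξ, (1 + ‖ξ‖ ^ 2) ^ 2 * ‖𝓕 w ξ‖ ^ 2 := by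
  rw [← v.integral_norm_sq_fourier, ← integral_const_mul]
  refine integral_mono (SchwartzMap.integrable_norm_sq (𝓕 v))
    ((integrable_fourier_sobolev_weight w).const_mul _) fun ξ => ?_
  calc ‖𝓕 v ξ‖ ^ 2 ≤ (A * ((1 + ‖ξ‖ ^ 2) * ‖𝓕 w ξ‖)) ^ 2 := by
        gcongr
        exact h ξ
    _ = A ^ 2 * ((1 + ‖ξ‖ ^ 2) ^ 2 * ‖𝓕 w ξ‖ ^ 2) := by ring

lemma norm_tangentialPart_le {d : ℕ} (ξ : EuclideanSpace ℝ (Fin (d + 1))) :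
    ‖tangentialPart ξ‖ ≤ ‖ξ‖ := by
  rw [EuclideanSpace.norm_eq, EuclideanSpace.norm_eq, Fin.sum_univ_castSucc]
  refine Real.sqrt_le_sqrt ?_
  simp only [tangentialPart]
  exact le_add_of_nonneg_right (by positivity)

/-- Trace estimate for a function with `|𝓕 v| ≤ A |ξ| |𝓕 w|`, where `𝓕 w` is supported in
`{|ξ| ≥ κ}`. -/
lemma integral_norm_sq_trace_le_of_fourier_le {d : ℕ}
    (v w : SchwartzMap (EuclideanSpace ℝ (Fin (d + 1))) ℂ) {κ A : ℝ} (hκ : 1 ≤ κ) (hA : 0 ≤ A)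
    (hw : ∀ ξ, ‖ξ‖ < κ → 𝓕 w ξ = 0) (hv : ∀ ξ, ‖𝓕 v ξ‖ ≤ A * (‖ξ‖ * ‖𝓕 w ξ‖)) (a : ℝ) :
    ∫ x' : EuclideanSpace ℝ (Fin d), ‖v (extendPt x' a)‖ ^ 2 ≤
      A ^ 2 * (1 + (2 * Real.pi) ^ 2) * κ⁻¹ * ∫ ξ, (1 + ‖ξ‖ ^ 2) ^ 2 * ‖𝓕 w ξ‖ ^ 2 := by
  have hκ0 : 0 < κ := by linarith
  have hlow : ∀ ξ, ‖𝓕 v ξ‖ ≤ A * κ⁻¹ * ((1 + ‖ξ‖ ^ 2) * ‖𝓕 w ξ‖) := by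
    intro ξ
    refine (hv ξ).trans ?_
    rcases lt_or_ge ‖ξ‖ κ with hξ | hξ
    · simp [hw ξ hξ]
    · have hgain : ‖ξ‖ ≤ κ⁻¹ * (1 + ‖ξ‖ ^ 2) := by
        rw [inv_mul_eq_div, le_div_iff₀ hκ0]
        nlinarith
      calc A * (‖ξ‖ * ‖𝓕 w ξ‖) ≤ A * (κ⁻¹ * (1 + ‖ξ‖ ^ 2) * ‖𝓕 w ξ‖) := by gcongr
        _ = A * κ⁻¹ * ((1 + ‖ξ‖ ^ 2) * ‖𝓕 w ξ‖) := by ring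
  have hhigh : ∀ ξ, ‖𝓕 (∂_{EuclideanSpace.single (Fin.last d) (1 : ℝ)} v) ξ‖ ≤
      2 * Real.pi * A * ((1 + ‖ξ‖ ^ 2) * ‖𝓕 w ξ‖) := by
    intro ξ
    calc _ ≤ 2 * Real.pi * ‖ξ‖ * ‖𝓕 v ξ‖ := norm_fourier_lineDerivOp_le v _ ξ
      _ ≤ 2 * Real.pi * ‖ξ‖ * (A * (‖ξ‖ * ‖𝓕 w ξ‖)) := by
          gcongr
          exact hv ξ
      _ = 2 * Real.pi * A * (‖ξ‖ ^ 2 * ‖𝓕 w ξ‖) := by ring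
      _ ≤ 2 * Real.pi * A * ((1 + ‖ξ‖ ^ 2) * ‖𝓕 w ξ‖) := by
          gcongr
          linarith
  have hL := integral_norm_sq_le_of_fourier_le v w hlow
  have hH := integral_norm_sq_le_of_fourier_le _ w hhigh
  refine (integral_norm_sq_trace_le v hκ0 a).trans ?_
  calc _ ≤ κ * ((A * κ⁻¹) ^ 2 * ∫ ξ, (1 + ‖ξ‖ ^ 2) ^ 2 * ‖𝓕 w ξ‖ ^ 2) +
        κ⁻¹ * ((2 * Real.pi * A) ^ 2 * ∫ ξ, (1 + ‖ξ‖ ^ 2) ^ 2 * ‖𝓕 w ξ‖ ^ 2) := by gcongr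
    _ = _ := by
        field_simp

/-!
STATEMENT 17: trace estimate with high-frequency gain.  For `θ ∈ (0,1/2)` there is a
constant `C(θ)` (depending only on `θ` and the dimension) such that, whenever `κ ≥ 1`
and `w` is a Schwartz function on `ℝⁿ` whose Fourier transform vanishes on
`{|ξ'| < κ}`, the `H¹`-trace of `w` on the hyperplane `{xₙ = 1}` satisfies
`‖w(·,1)‖²_{L²} + Σⱼ ‖∂ⱼ w(·,1)‖²_{L²} ≤ C(θ) κ^{−1+2θ} ∫ (1+|ξ|²)² |𝓕w(ξ)|² dξ`.
-/

theorem trace_high_frequency_gain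
    (d : ℕ) (hd : 1 ≤ d) (θ : ℝ) (hθ : θ ∈ Set.Ioo (0 : ℝ) (1 / 2)) :
    ∃ C > (0 : ℝ), ∀ κ : ℝ, 1 ≤ κ →
      ∀ w : SchwartzMap (EuclideanSpace ℝ (Fin (d + 1))) ℂ,
        (∀ ξ : EuclideanSpace ℝ (Fin (d + 1)), ‖tangentialPart ξ‖ < κ → 𝓕 (⇑w) ξ = 0) →
        (∫ x' : EuclideanSpace ℝ (Fin d), ‖w (extendPt x' 1)‖ ^ 2) +
          (∑ j : Fin d, ∫ x' : EuclideanSpace ℝ (Fin d),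
            ‖fderiv ℝ (⇑w) (extendPt x' 1) (EuclideanSpace.single (Fin.castSucc j) 1)‖ ^ 2)
        ≤ C * κ ^ (-1 + 2 * θ) *
            ∫ ξ : EuclideanSpace ℝ (Fin (d + 1)), (1 + ‖ξ‖ ^ 2) ^ 2 * ‖𝓕 (⇑w) ξ‖ ^ 2 := by
  refine ⟨(1 + d * (2 * Real.pi) ^ 2) * (1 + (2 * Real.pi) ^ 2), by positivity,
    fun κ hκ w hw => ?_⟩
  have hsupp : ∀ ξ, ‖ξ‖ < κ → 𝓕 w ξ = 0 := fun ξ hξ =>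
    hw ξ ((norm_tangentialPart_le ξ).trans_lt hξ)
  have htrace := integral_norm_sq_trace_le_of_fourier_le w w hκ zero_le_one hsupp (fun ξ => by
    rcases lt_or_ge ‖ξ‖ κ with hξ | hξ
    · simp [hsupp ξ hξ]
    · rw [one_mul]
      exact le_mul_of_one_le_left (norm_nonneg _) (hκ.trans hξ)) 1
  have hderiv := fun j : Fin d => integral_norm_sq_trace_le_of_fourier_le
    (∂_{EuclideanSpace.single (Fin.castSucc j) (1 : ℝ)} w) w hκ Real.two_pi_pos.le hsupp
    (fun ξ => (norm_fourier_lineDerivOp_le w _ ξ).trans_eq (mul_assoc _ _ _)) 1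
  have hpow : κ⁻¹ ≤ κ ^ (-1 + 2 * θ) := by
    rw [← Real.rpow_neg_one]
    exact Real.rpow_le_rpow_of_exponent_le hκ (by linarith [hθ.1])
  calc _ ≤ 1 ^ 2 * (1 + (2 * Real.pi) ^ 2) * κ⁻¹ * (∫ ξ, (1 + ‖ξ‖ ^ 2) ^ 2 * ‖𝓕 w ξ‖ ^ 2) +
        ∑ _j : Fin d, (2 * Real.pi) ^ 2 * (1 + (2 * Real.pi) ^ 2) * κ⁻¹ *
          ∫ ξ, (1 + ‖ξ‖ ^ 2) ^ 2 * ‖𝓕 w ξ‖ ^ 2 :=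
        add_le_add htrace (Finset.sum_le_sum fun j _ => hderiv j)
    _ = (1 + d * (2 * Real.pi) ^ 2) * (1 + (2 * Real.pi) ^ 2) * κ⁻¹ *
          ∫ ξ, (1 + ‖ξ‖ ^ 2) ^ 2 * ‖𝓕 w ξ‖ ^ 2 := by
        rw [Finset.sum_const, Finset.card_univ, Fintype.card_fin, nsmul_eq_mul]
        ring
    _ ≤ (1 + d * (2 * Real.pi) ^ 2) * (1 + (2 * Real.pi) ^ 2) * κ ^ (-1 + 2 * θ) *
          ∫ ξ, (1 + ‖ξ‖ ^ 2) ^ 2 * ‖𝓕 w ξ‖ ^ 2 := by gcongr
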